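/- Let m > l ≥ 1, n ≥ 1, and fix vectors p_1, …, p_{m−l}, q_1, …, q_{m−l}, x_1, …, x_l ∈ ℝ^(m+n) such that the m vectors p_1, …, p_{m−l}, x_1, …, x_l are linearly independent. Then the following are equivalent: (i) for every u ∈ ℝ there exists λ ∈ ℝ such that (p_1 + u·q_1) ∧ ⋯ ∧ (p_{m−l} + u·q_{m−l}) ∧ x_1 ∧ ⋯ ∧ x_l = λ · (p_1 ∧ ⋯ ∧ p_{m−l} ∧ x_1 ∧ ⋯ ∧ x_l) in the exterior algebra of ℝ^(m+n); (ii) for every s ∈ {1, …, m−l}, q_s ∧ p_1 ∧ ⋯ ∧ p_{m−l} ∧ x_1 ∧ ⋯ ∧ x_l = 0. -/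

import Mathlib

/-- The wedge product `v₁ ∧ ⋯ ∧ vₗ` of a list of vectors, as the product of
their images in the exterior algebra. -/
noncomputable def wedgeList {V : Type*} [AddCommGroup V] [Module ℝ V]
    (l : List V) : ExteriorAlgebra ℝ V :=
  (l.map (ExteriorAlgebra.ι ℝ)).prod

theorem wedgeList_ofFn {V : Type*} [AddCommGroup V] [Module ℝ V] {k : ℕ} (v : Fin k → V) :
    wedgeList (List.ofFn v) = ExteriorAlgebra.ιMulti ℝ k v := by
  simp [wedgeList, ExteriorAlgebra.ιMulti_apply, List.map_ofFn, Function.comp_def]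

theorem wedgeList_ofFn_append {V : Type*} [AddCommGroup V] [Module ℝ V] {j k : ℕ}
    (v : Fin j → V) (w : Fin k → V) :
    wedgeList (List.ofFn v ++ List.ofFn w) =
      ExteriorAlgebra.ιMulti ℝ (j + k) (Fin.append v w) := by
  rw [← wedgeList_ofFn, List.ofFn_fin_append]

theorem wedgeList_cons {V : Type*} [AddCommGroup V] [Module ℝ V] (a : V) (L : List V) :
    wedgeList (a :: L) = ExteriorAlgebra.ι ℝ a * wedgeList L := by
  simp [wedgeList]

theorem linearIndependent_fin_append_iff {K V : Type*} [DivisionRing K] [AddCommGroup V]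
    [Module K V] {j k : ℕ} (v : Fin j → V) (w : Fin k → V) :
    LinearIndependent K (Fin.append v w) ↔ LinearIndependent K (Sum.elim v w) := by
  rw [← linearIndependent_equiv finSumFinEquiv]
  congr! 1
  ext (i | i) <;> simp

theorem AlternatingMap.map_eq_det_smul_map_basis {R M N ι : Type*} [CommRing R] [AddCommGroup M]
    [Module R M] [AddCommGroup N] [Module R N] [Fintype ι] [DecidableEq ι]
    (f : M [⋀^ι]→ₗ[R] N) (b : Module.Basis ι R M) (v : ι → M) :
    f v = b.det v • f b := by
  suffices h : f = (LinearMap.toSpanSingleton R N (f b)).compAlternatingMap b.det from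
    DFunLike.congr_fun h v
  refine Module.Basis.ext_alternating b fun σ hσ => ?_
  let τ : Equiv.Perm ι := Equiv.ofBijective σ (Finite.injective_iff_bijective.1 hσ)
  have hf := f.map_perm b τ
  have hdet := b.det.map_perm b τ
  rw [b.det_self] at hdet
  change f (b ∘ τ) = b.det (b ∘ τ) • f b
  rw [hf, hdet, smul_assoc, one_smul]

/-- A wedge of vectors in the span of a linearly independent family `v` of the same length is a
multiple of the wedge of `v`. -/
theorem exists_ιMulti_eq_smul_of_mem_span {K V : Type*} [Field K] [AddCommGroup V] [Module K V]
    {k : ℕ} {v w : Fin k → V} (hv : LinearIndependent K v)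
    (hw : ∀ i, w i ∈ Submodule.span K (Set.range v)) :
    ∃ c : K, ExteriorAlgebra.ιMulti K k w = c • ExteriorAlgebra.ιMulti K k v := by
  let b := Module.Basis.span hv
  let f := (ExteriorAlgebra.ιMulti K k).compLinearMap
    (Submodule.span K (Set.range v)).subtype
  refine ⟨b.det fun i => ⟨w i, hw i⟩, ?_⟩
  have hf : f (fun i => ⟨w i, hw i⟩) = b.det (fun i => ⟨w i, hw i⟩) • f b :=
    f.map_eq_det_smul_map_basis b _
  have hb : f b = ExteriorAlgebra.ιMulti K k v := by
    simp [f, b, Module.Basis.span_apply]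
  rw [← hb, ← hf]
  simp [f]

theorem ιMulti_ne_zero_of_linearIndependent {K V : Type*} [Field K] [AddCommGroup V] [Module K V]
    {k : ℕ} {v : Fin k → V} (hv : LinearIndependent K v) :
    ExteriorAlgebra.ιMulti K k v ≠ 0 := by
  let b := Module.Basis.span hv
  obtain ⟨g, hg⟩ := LinearMap.exists_leftInverse_of_injective
    (Submodule.span K (Set.range v)).subtype (Submodule.ker_subtype _)
  have hgv : g ∘ v = b := by
    funext i
    have hi : v i = (Submodule.span K (Set.range v)).subtype (b i) := by
      simp [b, Module.Basis.span_apply]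
    rw [Function.comp_apply, hi]
    exact LinearMap.congr_fun hg (b i)
  let f := b.det.compLinearMap g
  have hf : f v = 1 := by
    have h : f v = b.det (g ∘ v) := rfl
    rw [h, hgv, b.det_self]
  intro h0
  have h1 := exteriorPower.alternatingMapLinearEquiv_apply_ιMulti f v
  have h2 : exteriorPower.ιMulti K k v = 0 := Subtype.ext h0
  rw [h2, map_zero, hf] at h1
  exact zero_ne_one h1

theorem ι_mul_ιMulti_eq_zero_iff {K V : Type*} [Field K] [AddCommGroup V] [Module K V]
    {k : ℕ} {v : Fin k → V} (hv : LinearIndependent K v) (a : V) :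
    ExteriorAlgebra.ι K a * ExteriorAlgebra.ιMulti K k v = 0 ↔
      a ∈ Submodule.span K (Set.range v) := by
  have hcons : ExteriorAlgebra.ι K a * ExteriorAlgebra.ιMulti K k v =
      ExteriorAlgebra.ιMulti K (k + 1) (Fin.cons a v) := by
    simp [ExteriorAlgebra.ιMulti_succ_apply, Matrix.vecTail, Function.comp_def]
  rw [hcons]
  constructor
  · intro h
    by_contra ha
    exact ιMulti_ne_zero_of_linearIndependent (linearIndependent_finCons.2 ⟨hv, ha⟩) h
  · intro ha
    exact AlternatingMap.map_linearDependent _ _ fun h => (linearIndependent_finCons.1 h).2 ha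

/-- Vectors with proportional nonzero wedges span the same space. -/
theorem mem_span_of_ιMulti_eq_smul {K V : Type*} [Field K] [AddCommGroup V] [Module K V]
    {k : ℕ} {v w : Fin k → V} (hv : LinearIndependent K v) (hw : LinearIndependent K w) {c : K}
    (h : ExteriorAlgebra.ιMulti K k w = c • ExteriorAlgebra.ιMulti K k v) (i : Fin k) :
    w i ∈ Submodule.span K (Set.range v) := by
  have hc : c ≠ 0 := by
    rintro rfl
    exact ιMulti_ne_zero_of_linearIndependent hw (by rw [h, zero_smul])
  have hi := (ι_mul_ιMulti_eq_zero_iff hw (w i)).2 (Submodule.subset_span ⟨i, rfl⟩)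
  rw [h, mul_smul_comm] at hi
  exact (ι_mul_ιMulti_eq_zero_iff hv _).1 ((smul_eq_zero.1 hi).resolve_left hc)

theorem exists_ne_zero_linearIndependent_add_smul {ι V : Type*} [Finite ι] [NormedAddCommGroup V]
    [NormedSpace ℝ V] {v : ι → V} (hv : LinearIndependent ℝ v) (d : ι → V) :
    ∃ u : ℝ, u ≠ 0 ∧ LinearIndependent ℝ (v + u • d) := by
  have hcont : Continuous fun u : ℝ => v + u • d := by fun_prop
  have hopen := (isOpen_setOfPred_linearIndependent (𝕜 := ℝ) (E := V) (ι := ι)).preimage hcont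
  have hmem : ∀ᶠ u : ℝ in nhds 0, LinearIndependent ℝ (v + u • d) :=
    hopen.mem_nhds (by simpa using hv)
  obtain ⟨u, hu, hu0⟩ :=
    ((hmem.filter_mono nhdsWithin_le_nhds).and
      (self_mem_nhdsWithin : {(0 : ℝ)}ᶜ ∈ nhdsWithin (0 : ℝ) {0}ᶜ)).exists
  exact ⟨u, hu0, hu⟩

/-- **Pointwise developability criterion over a higher-dimensional base.**
Given vectors `p₁, …, p_{m-l}, x₁, …, x_l` in `ℝ^(m+n)` that are linearly
independent and vectors `q₁, …, q_{m-l}`, the `m`-vector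
`(p₁ + u•q₁) ∧ ⋯ ∧ (p_{m-l} + u•q_{m-l}) ∧ x₁ ∧ ⋯ ∧ x_l` is a scalar multiple of
`p₁ ∧ ⋯ ∧ p_{m-l} ∧ x₁ ∧ ⋯ ∧ x_l` for every `u : ℝ` iff
`q_s ∧ p₁ ∧ ⋯ ∧ p_{m-l} ∧ x₁ ∧ ⋯ ∧ x_l = 0` for every `s`. -/
theorem ruled_tangent_constant_iff_wedge_zero_general_base
    (m l n : ℕ) (hl : 1 ≤ l) (hml : l < m) (hn : 1 ≤ n)
    (p q : Fin (m - l) → EuclideanSpace ℝ (Fin (m + n)))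
    (x : Fin l → EuclideanSpace ℝ (Fin (m + n)))
    (hind : LinearIndependent ℝ (Sum.elim p x)) :
    (∀ u : ℝ, ∃ lam : ℝ,
        wedgeList (List.ofFn (fun s => p s + u • q s) ++ List.ofFn x)
          = lam • wedgeList (List.ofFn p ++ List.ofFn x)) ↔
      ∀ s, wedgeList (q s :: (List.ofFn p ++ List.ofFn x)) = 0 := by
  have hv := (linearIndependent_fin_append_iff p x).2 hind
  simp only [wedgeList_cons, wedgeList_ofFn_append, ι_mul_ιMulti_eq_zero_iff hv]
  have hp (s) : p s ∈ Submodule.span ℝ (Set.range (Fin.append p x)) :=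
    Submodule.subset_span ⟨Fin.castAdd l s, Fin.append_left p x s⟩
  have hx (j) : x j ∈ Submodule.span ℝ (Set.range (Fin.append p x)) :=
    Submodule.subset_span ⟨Fin.natAdd (m - l) j, Fin.append_right p x j⟩
  constructor
  · intro h s
    obtain ⟨u, hu0, hu⟩ := exists_ne_zero_linearIndependent_add_smul hind (Sum.elim q 0)
    have hsum : Sum.elim p x + u • Sum.elim q 0 = Sum.elim (fun s => p s + u • q s) x := by
      ext (i | i) <;> simp
    rw [hsum, ← linearIndependent_fin_append_iff] at hu
    obtain ⟨c, hc⟩ := h u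
    have hs := mem_span_of_ιMulti_eq_smul hv hu hc (Fin.castAdd l s)
    rw [Fin.append_left] at hs
    exact (Submodule.smul_mem_iff _ hu0).1 ((Submodule.add_mem_iff_right _ (hp s)).1 hs)
  · intro h u
    refine exists_ιMulti_eq_smul_of_mem_span hv fun i => ?_
    refine Fin.addCases (fun s => ?_) (fun j => ?_) i
    · rw [Fin.append_left]
      exact add_mem (hp s) (Submodule.smul_mem _ u (h s))
    · rw [Fin.append_right]
      exact hx j
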